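/- Let j, k, m be non-negative integers and n a positive integer with n > k and m < j. Then the graph Γ_ℝ(X^{2j+1} Y^{2k+1}, X^{2m+1} Y^{2n}) has girth six. -/

import Mathlib

/-- The algebraically defined bipartite graph `Γ_R(f₂, f₃)`: the first summand consists of
points `(a₁,a₂,a₃)`, the second of lines `[x₁,x₂,x₃]`; a point is adjacent to a line iff
`a₂ + x₂ = f₂ (a₁, x₁)` and `a₃ + x₃ = f₃ (a₁, x₁)`. -/
def adGraph (R : Type*) [CommRing R] (f₂ f₃ : R × R → R) :
    SimpleGraph ((R × R × R) ⊕ (R × R × R)) :=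
  SimpleGraph.fromRel (fun u v =>
    ∃ a x : R × R × R, u = Sum.inl a ∧ v = Sum.inr x ∧
      a.2.1 + x.2.1 = f₂ (a.1, x.1) ∧ a.2.2 + x.2.2 = f₃ (a.1, x.1))

/-- The real monomial graph `Γ_ℝ(X^s Y^t, X^u Y^v)`. -/
noncomputable def monGraph (s t u v : ℕ) : SimpleGraph ((ℝ × ℝ × ℝ) ⊕ (ℝ × ℝ × ℝ)) :=
  adGraph ℝ (fun p => p.1 ^ s * p.2 ^ t) (fun p => p.1 ^ u * p.2 ^ v)

section

variable {R : Type*} [CommRing R] {f₂ f₃ : R × R → R}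

theorem adGraph_adj_inl_inr (a x : R × R × R) :
    (adGraph R f₂ f₃).Adj (Sum.inl a) (Sum.inr x) ↔
      a.2.1 + x.2.1 = f₂ (a.1, x.1) ∧ a.2.2 + x.2.2 = f₃ (a.1, x.1) := by
  simp only [adGraph, SimpleGraph.fromRel_adj]
  constructor
  · rintro ⟨-, ⟨_, _, ha, hx, h⟩ | ⟨_, _, ha, -⟩⟩
    · cases ha
      cases hx
      exact h
    · cases ha
  · exact fun h => ⟨Sum.inl_ne_inr, .inl ⟨a, x, rfl, rfl, h⟩⟩

theorem adGraph_not_adj_inl_inl (a b : R × R × R) :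
    ¬ (adGraph R f₂ f₃).Adj (Sum.inl a) (Sum.inl b) := by
  simp [adGraph]

theorem adGraph_not_adj_inr_inr (x y : R × R × R) :
    ¬ (adGraph R f₂ f₃).Adj (Sum.inr x) (Sum.inr y) := by
  simp [adGraph]

theorem adGraph_isLeft_of_adj {u v : (R × R × R) ⊕ (R × R × R)}
    (h : (adGraph R f₂ f₃).Adj u v) : v.isLeft = !u.isLeft := by
  rcases u with a | x <;> rcases v with b | y
  · exact absurd h (adGraph_not_adj_inl_inl a b)
  · rfl
  · rfl
  · exact absurd h (adGraph_not_adj_inr_inr x y)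

/-- If the alternating sum of `f₂` never vanishes on nondegenerate quadruples, two points with two
common neighbours coincide, or the two neighbours do. -/
theorem adGraph_eq_or_eq_of_common_neighbors
    (hf : ∀ a b x y : R, f₂ (a, x) - f₂ (b, x) + f₂ (b, y) - f₂ (a, y) = 0 → a = b ∨ x = y)
    {a b x y : R × R × R}
    (hax : (adGraph R f₂ f₃).Adj (Sum.inl a) (Sum.inr x))
    (hbx : (adGraph R f₂ f₃).Adj (Sum.inl b) (Sum.inr x))
    (hby : (adGraph R f₂ f₃).Adj (Sum.inl b) (Sum.inr y))
    (hay : (adGraph R f₂ f₃).Adj (Sum.inl a) (Sum.inr y)) : a = b ∨ x = y := by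
  rw [adGraph_adj_inl_inr] at hax hbx hby hay
  obtain ⟨a₁, a₂, a₃⟩ := a
  obtain ⟨b₁, b₂, b₃⟩ := b
  obtain ⟨x₁, x₂, x₃⟩ := x
  obtain ⟨y₁, y₂, y₃⟩ := y
  dsimp only at hax hbx hby hay
  rcases hf a₁ b₁ x₁ y₁ (by rw [← hax.1, ← hbx.1, ← hby.1, ← hay.1]; ring) with rfl | rfl
  · left
    simp only [Prod.mk.injEq, true_and]
    exact ⟨add_right_cancel (hax.1.trans hbx.1.symm), add_right_cancel (hax.2.trans hbx.2.symm)⟩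
  · right
    simp only [Prod.mk.injEq, true_and]
    exact ⟨add_left_cancel (hax.1.trans hay.1.symm), add_left_cancel (hax.2.trans hay.2.symm)⟩

theorem six_le_egirth_adGraph
    (hf : ∀ a b x y : R, f₂ (a, x) - f₂ (b, x) + f₂ (b, y) - f₂ (a, y) = 0 → a = b ∨ x = y) :
    6 ≤ (adGraph R f₂ f₃).egirth := by
  rw [SimpleGraph.le_egirth]
  intro u w hw
  have h3 := hw.three_le_length
  suffices 6 ≤ w.length by exact_mod_cast this
  by_contra! hlt
  match w, hw, h3, hlt with
  | .cons h₁ (.cons h₂ (.cons h₃ .nil)), _, _, _ =>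
    have e₁ := adGraph_isLeft_of_adj h₁
    have e₂ := adGraph_isLeft_of_adj h₂
    have e₃ := adGraph_isLeft_of_adj h₃
    grind
  | .cons (v := p) h₁ (.cons (v := q) h₂ (.cons (v := r) h₃ (.cons h₄ .nil))), hw, _, _ =>
    have hn := hw.support_nodup
    simp only [SimpleGraph.Walk.support_cons, SimpleGraph.Walk.support_nil, List.tail_cons,
      List.nodup_cons, List.mem_cons, not_or] at hn
    have hpr : p ≠ r := hn.1.2.1
    have huq : q ≠ u := hn.2.1.2.1
    have e₁ := adGraph_isLeft_of_adj h₁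
    have e₂ := adGraph_isLeft_of_adj h₂
    have e₃ := adGraph_isLeft_of_adj h₃
    rcases u with u | u <;> rcases p with p | p <;> rcases q with q | q <;>
      rcases r with r | r <;> simp at e₁ e₂ e₃
    · rcases adGraph_eq_or_eq_of_common_neighbors hf h₁ h₂.symm h₃ h₄.symm with rfl | rfl
      · exact huq rfl
      · exact hpr rfl
    · rcases adGraph_eq_or_eq_of_common_neighbors hf h₂ h₃.symm h₄ h₁.symm with rfl | rfl
      · exact hpr rfl
      · exact huq rfl
  | .cons h₁ (.cons h₂ (.cons h₃ (.cons h₄ (.cons h₅ .nil)))), _, _, _ =>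
    have e₁ := adGraph_isLeft_of_adj h₁
    have e₂ := adGraph_isLeft_of_adj h₂
    have e₃ := adGraph_isLeft_of_adj h₃
    have e₄ := adGraph_isLeft_of_adj h₄
    have e₅ := adGraph_isLeft_of_adj h₅
    grind
  | .cons _ (.cons _ (.cons _ (.cons _ (.cons _ (.cons _ _))))), _, _, h =>
    simp only [SimpleGraph.Walk.length_cons] at h
    omega

theorem egirth_adGraph_le_six {a b c x y z : R}
    (hab : a ≠ b) (hbc : b ≠ c) (hca : c ≠ a) (hxy : x ≠ y) (hyz : y ≠ z) (hzx : z ≠ x)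
    (h₂ : f₂ (a, x) - f₂ (b, x) + f₂ (b, y) - f₂ (c, y) + f₂ (c, z) - f₂ (a, z) = 0)
    (h₃ : f₃ (a, x) - f₃ (b, x) + f₃ (b, y) - f₃ (c, y) + f₃ (c, z) - f₃ (a, z) = 0) :
    (adGraph R f₂ f₃).egirth ≤ 6 := by
  let G := adGraph R f₂ f₃
  let A : R × R × R := (a, 0, 0)
  let X : R × R × R := (x, f₂ (a, x), f₃ (a, x))
  let B : R × R × R := (b, f₂ (b, x) - X.2.1, f₃ (b, x) - X.2.2)
  let Y : R × R × R := (y, f₂ (b, y) - B.2.1, f₃ (b, y) - B.2.2)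
  let C : R × R × R := (c, f₂ (c, y) - Y.2.1, f₃ (c, y) - Y.2.2)
  let Z : R × R × R := (z, f₂ (c, z) - C.2.1, f₃ (c, z) - C.2.2)
  have hAX : G.Adj (.inl A) (.inr X) := by simp [G, adGraph_adj_inl_inr, A, X]
  have hBX : G.Adj (.inl B) (.inr X) := by simp [G, adGraph_adj_inl_inr, B, X]
  have hBY : G.Adj (.inl B) (.inr Y) := by simp [G, adGraph_adj_inl_inr, B, Y]
  have hCY : G.Adj (.inl C) (.inr Y) := by simp [G, adGraph_adj_inl_inr, C, Y]
  have hCZ : G.Adj (.inl C) (.inr Z) := by simp [G, adGraph_adj_inl_inr, C, Z]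
  have hAZ : G.Adj (.inl A) (.inr Z) := by
    rw [adGraph_adj_inl_inr]
    dsimp only [A, B, C, X, Y, Z]
    exact ⟨by linear_combination h₂, by linear_combination h₃⟩
  have nAB : A ≠ B := fun h => hab (congrArg Prod.fst h)
  have nBC : B ≠ C := fun h => hbc (congrArg Prod.fst h)
  have nCA : C ≠ A := fun h => hca (congrArg Prod.fst h)
  have nXY : X ≠ Y := fun h => hxy (congrArg Prod.fst h)
  have nYZ : Y ≠ Z := fun h => hyz (congrArg Prod.fst h)
  have nZX : Z ≠ X := fun h => hzx (congrArg Prod.fst h)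
  clear_value A B C X Y Z
  let w : G.Walk (.inl A) (.inl A) :=
    .cons hAX (.cons hBX.symm (.cons hBY (.cons hCY.symm (.cons hCZ (.cons hAZ.symm .nil)))))
  have hw : w.IsCycle := by
    rw [SimpleGraph.Walk.isCycle_def]
    refine ⟨?_, by simp [w], ?_⟩
    · rw [SimpleGraph.Walk.isTrail_def]
      simp [w, nAB, nAB.symm, nBC, nCA, nCA.symm, nXY, nYZ, nZX.symm]
    · simp [w, nAB.symm, nBC, nCA, nXY, nYZ, nZX.symm]
  simpa [w] using SimpleGraph.egirth_le_length hw

end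

theorem Odd.exists_real_pow_eq {t : ℕ} (ht : Odd t) (r : ℝ) : ∃ z : ℝ, z ^ t = r := by
  rcases le_total 0 r with hr | hr
  · exact ⟨r ^ (t : ℝ)⁻¹, Real.rpow_inv_natCast_pow hr ht.pos.ne'⟩
  · exact ⟨-(-r) ^ (t : ℝ)⁻¹, by
      rw [ht.neg_pow, Real.rpow_inv_natCast_pow (neg_nonneg.2 hr) ht.pos.ne', neg_neg]⟩

theorem exists_one_sub_pow_pow_lt {s t u v : ℕ} (ht : t ≠ 0) (hv : v ≠ 0) (hus : u < s) :
    ∃ b : ℝ, 0 < b ∧ b < 1 ∧ (1 - b ^ u) ^ t < (1 - b ^ s) ^ v := by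
  have hv0 : (0 : ℝ) < v := by exact_mod_cast Nat.pos_of_ne_zero hv
  set b : ℝ := 1 / (v + 1) with hb
  have hb0 : 0 < b := by positivity
  have hvb : v * b < 1 := by
    rw [hb, mul_one_div, div_lt_one (by positivity)]
    linarith
  have hb1 : b < 1 := by
    rw [hb, div_lt_one (by positivity)]
    linarith
  refine ⟨b, hb0, hb1, ?_⟩
  have hu1 : b ^ u ≤ 1 := pow_le_one₀ hb0.le hb1.le
  have hs1 : b ^ s ≤ 1 := pow_le_one₀ hb0.le hb1.le
  have hsu : b ^ s ≤ b ^ u * b := by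
    rw [← pow_succ]
    exact pow_le_pow_of_le_one hb0.le hb1.le hus
  have hup : 0 < b ^ u := by positivity
  calc (1 - b ^ u) ^ t ≤ 1 - b ^ u :=
        pow_le_of_le_one (sub_nonneg.2 hu1) (by linarith) ht
    _ < 1 + v * (-b ^ s) := by nlinarith
    _ ≤ (1 + -b ^ s) ^ v := one_add_mul_le_pow (by linarith) v
    _ = (1 - b ^ s) ^ v := by rw [← sub_eq_add_neg]

theorem egirth_monGraph_le_six {s t u v : ℕ} (ht : Odd t) (hv : Even v) (hv0 : v ≠ 0)
    (hu : u ≠ 0) (hus : u < s) : (monGraph s t u v).egirth ≤ 6 := by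
  obtain ⟨b, hb0, hb1, hb⟩ := exists_one_sub_pow_pow_lt ht.pos.ne' hv0 hus
  have hs : s ≠ 0 := by omega
  have hbs0 : 0 < b ^ s := by positivity
  have hbs1 : b ^ s < 1 := pow_lt_one₀ hb0.le hb1 hs
  have hcont : Continuous fun y : ℝ =>
      ((1 - b ^ u) + b ^ u * y ^ v) ^ t - (-(1 - b ^ s) + b ^ s * y ^ t) ^ v := by fun_prop
  obtain ⟨y, ⟨hy0, hy1⟩, hy⟩ := intermediate_value_Icc (zero_le_one' ℝ) hcont.continuousOn
    (show (0 : ℝ) ∈ _ by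
      constructor
      · simp only [zero_pow hv0, zero_pow ht.pos.ne', mul_zero, add_zero, hv.neg_pow]
        linarith
      · simp only [one_pow, mul_one, sub_add_cancel, sub_nonneg]
        rw [← hv.pow_abs]
        exact pow_le_one₀ (abs_nonneg _) (abs_le.2 ⟨by linarith, by linarith⟩))
  obtain ⟨z, hz⟩ := ht.exists_real_pow_eq (-(1 - b ^ s) + b ^ s * y ^ t)
  have hzv : z ^ v = (1 - b ^ u) + b ^ u * y ^ v := by
    apply ht.strictMono_pow.injective
    simp only
    rw [← pow_mul, mul_comm, pow_mul, hz]
    dsimp only at hy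
    linarith
  have hyt : 0 ≤ y ^ t := by positivity
  refine egirth_adGraph_le_six (a := 1) (b := b) (c := 0) (x := -1) (y := y) (z := z)
    hb1.ne' hb0.ne' zero_ne_one (by linarith) ?_ ?_ ?_ ?_
  · rintro rfl
    nlinarith
  · rintro rfl
    rw [ht.neg_one_pow] at hz
    nlinarith
  · simp only [one_pow, ht.neg_one_pow, zero_pow hs, hz]
    ring
  · simp only [one_pow, hv.neg_one_pow, zero_pow hu, hzv]
    ring

theorem six_le_egirth_monGraph {s t : ℕ} (hs : Odd s) (ht : Odd t) (u v : ℕ) :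
    6 ≤ (monGraph s t u v).egirth := by
  refine six_le_egirth_adGraph fun a b x y h => ?_
  have h' : (a ^ s - b ^ s) * (x ^ t - y ^ t) = 0 := by linear_combination h
  rcases mul_eq_zero.1 h' with h' | h'
  · exact .inl (hs.strictMono_pow.injective (sub_eq_zero.1 h'))
  · exact .inr (ht.strictMono_pow.injective (sub_eq_zero.1 h'))

theorem girth_six_of_k_lt_n_m_lt_j (j k m n : ℕ) (hn : 0 < n) (hnk : k < n) (hmj : m < j) :
    (monGraph (2 * j + 1) (2 * k + 1) (2 * m + 1) (2 * n)).egirth = 6 :=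
  le_antisymm
    (egirth_monGraph_le_six (odd_two_mul_add_one k) (even_two_mul n) (by omega) (by omega)
      (by omega))
    (six_le_egirth_monGraph (odd_two_mul_add_one j) (odd_two_mul_add_one k) _ _)
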